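/- For Vein's Abel equation, the normal-form invariant I(x) = [d/dx(f₂/(3f₃)) - f₁f₂/(3f₃) + 2f₂³/(27f₃²)] / (f₃ω³), with ω(x) = (a²+bx)/(x³-3abx-a³-b³), is identically equal to -1 at every x where all denominators are nonzero. -/

import Mathlib

theorem vein_invariant (a b x : ℝ)
    (h1 : b * x + a ^ 2 ≠ 0)
    (h2 : x ^ 3 - 3 * a * b * x - a ^ 3 - b ^ 3 ≠ 0) :
    let f1 : ℝ → ℝ := fun x => -2 * b / (b * x + a ^ 2)
    let f2 : ℝ → ℝ := fun x => 3 * (a * x + b ^ 2) / (b * x + a ^ 2)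
    let f3 : ℝ → ℝ := fun x => (x ^ 3 - 3 * a * b * x - a ^ 3 - b ^ 3) / (b * x + a ^ 2)
    let ω : ℝ → ℝ := fun x => (a ^ 2 + b * x) / (x ^ 3 - 3 * a * b * x - a ^ 3 - b ^ 3)
    (deriv (fun x => f2 x / (3 * f3 x)) x - f1 x * f2 x / (3 * f3 x)
        + 2 * f2 x ^ 3 / (27 * f3 x ^ 2)) / (f3 x * ω x ^ 3) = -1 := by
  intro f1 f2 f3 ω
  have hQ : ∀ᶠ y in nhds x, b * y + a ^ 2 ≠ 0 :=
    ContinuousAt.eventually_ne (by fun_prop) h1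
  have hC : HasDerivAt (fun y : ℝ => y ^ 3 - 3 * a * b * y - a ^ 3 - b ^ 3)
      (3 * x ^ 2 - 3 * a * b) x := by
    have h := ((((hasDerivAt_id x).pow 3).sub ((hasDerivAt_id x).const_mul (3 * a * b))).sub_const
      (a ^ 3)).sub_const (b ^ 3)
    exact h.congr_deriv (by simp)
  have hP : HasDerivAt (fun y : ℝ => a * y + b ^ 2) a x := by
    have h := ((hasDerivAt_id x).const_mul a).add_const (b ^ 2)
    exact h.congr_deriv (by simp)
  have heq : (fun y => f2 y / (3 * f3 y)) =ᶠ[nhds x]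
      (fun y => (a * y + b ^ 2) / (y ^ 3 - 3 * a * b * y - a ^ 3 - b ^ 3)) := by
    filter_upwards [hQ] with y hy
    simp only [f2, f3]
    rw [← mul_div_assoc, div_div_div_cancel_right₀ hy, mul_div_mul_left _ _ (by norm_num)]
  rw [heq.deriv_eq, (hP.fun_div hC h2).deriv]
  simp only [f1, f2, f3, ω]
  rw [add_comm (a ^ 2) (b * x)]
  have key : (b * x + a ^ 2) * (a * (x ^ 3 - 3 * a * b * x - a ^ 3 - b ^ 3)
      - (a * x + b ^ 2) * (3 * x ^ 2 - 3 * a * b))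
      + 2 * (a * x + b ^ 2) * (b * (x ^ 3 - 3 * a * b * x - a ^ 3 - b ^ 3) + (a * x + b ^ 2) ^ 2)
      = -(b * x + a ^ 2) ^ 3 := by ring
  generalize x ^ 3 - 3 * a * b * x - a ^ 3 - b ^ 3 = C at *
  generalize b * x + a ^ 2 = Q at *
  generalize a * x + b ^ 2 = P at *
  generalize 3 * x ^ 2 - 3 * a * b = D at *
  field_simp
  linear_combination 27 * key
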